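/- arXiv:2604.15894 — 2 statements merged into one kernel-verified Lean document; each statement's English description precedes it below -/
import Mathlib

section
/- If there exists a strong ω₂-chain of functions from ω₁ to ω₁, then the Continuum Hypothesis fails, i.e., 2^{ℵ₀} > ℵ₁. -/
open Cardinal Ordinal

/-- The type of countable ordinals, i.e. ordinals below `ω₁`. -/
abbrev Omega1 : Type _ := {ξ : Ordinal // ξ < (Cardinal.aleph 1).ord}

/-- There are `ℵ₁` countable ordinals. -/
theorem mk_Omega1 : #Omega1 = ℵ_ 1 := by
  have h : #Omega1 = Cardinal.lift (ℵ_ 1).ord.card := Cardinal.mk_Iio_ordinal (ℵ_ 1).ord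
  simpa using h

universe u v

/-- Under the Continuum Hypothesis there are at most `ℵ₁` sequences of countable ordinals. -/
theorem mk_nat_fun_Omega1_le (hCH : (2 : Cardinal.{u}) ^ ℵ₀ ≤ ℵ_ 1) : #(ℕ → Omega1.{v}) ≤ ℵ_ 1 := by
  have hle : (2 : Cardinal.{v + 1}) ^ ℵ₀ ≤ ℵ_ 1 := by
    rw [← Cardinal.lift_le.{u}]
    simpa using Cardinal.lift_le.{v + 1}.2 hCH
  calc #(ℕ → Omega1.{v}) = ℵ_ 1 ^ ℵ₀ := by simp [mk_Omega1]
    _ ≤ (2 ^ ℵ₀) ^ ℵ₀ := power_le_power_right (by simpa using aleph_one_le_continuum)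
    _ = 2 ^ ℵ₀ := by rw [← power_mul, aleph0_mul_aleph0]
    _ ≤ ℵ_ 1 := hle

/-- If there exists a strong `ω₂`-chain of functions from `ω₁` to `ω₁`, then the
Continuum Hypothesis fails: `ℵ₁ < 2 ^ ℵ₀`. -/
theorem not_CH_of_strong_omega2_chain_of_functions
    (f : Ordinal → (Omega1 → Omega1))
    (hf : ∀ α β : Ordinal, α < β → β < (Cardinal.aleph 2).ord →
      {ξ : Omega1 | f β ξ ≤ f α ξ}.Finite) :
    Cardinal.aleph 1 < 2 ^ Cardinal.aleph0 := by
  by_contra hCH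
  rw [not_lt] at hCH
  have : Infinite Omega1 := by
    rw [infinite_iff, mk_Omega1]
    exact aleph0_le_aleph 1
  let e := Infinite.natEmbedding Omega1
  let g : Set.Iio (ℵ_ 2).ord → ℕ → Omega1 := fun α n => f α (e n)
  have ne_of_lt : ∀ α β : Set.Iio (ℵ_ 2).ord, α < β → g α ≠ g β := by
    intro α β hαβ heq
    refine Set.infinite_range_of_injective e.injective ((hf α β hαβ β.2).subset ?_)
    rintro _ ⟨n, rfl⟩
    exact (congrFun heq n).ge
  have hg : Function.Injective g := by
    intro α β heq
    rcases lt_trichotomy α β with h | h | h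
    · exact (ne_of_lt α β h heq).elim
    · exact h
    · exact (ne_of_lt β α h heq.symm).elim
  have hcard := (lift_mk_le_lift_mk_of_injective hg).trans
    (Cardinal.lift_le.2 (mk_nat_fun_Omega1_le hCH))
  rw [Cardinal.mk_Iio_ordinal] at hcard
  simp at hcard
end

section
/- For every infinite cardinal λ, there is no sequence ⟨f_α : α < λ⁺⁺⁺⟩ of functions from λ⁺⁺ to λ⁺⁺ increasing modulo the ideal [λ⁺⁺]^{<λ}: that is, there is no such sequence with the property that for all α < β < λ⁺⁺⁺, the set {ξ < λ⁺⁺ : f_α(ξ) ≥ f_β(ξ)} has cardinality strictly less than λ. (Theorem of Shelah, stated in the paper.) -/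
open Cardinal Ordinal

universe u

theorem exists_forall_lt_of_mk_lt_cof {α : Type u} [LinearOrder α] {s : Set α}
    (hs : #s < Order.cof α) : ∃ a, ∀ b ∈ s, b < a := by
  by_contra! h
  exact (Order.cof_le (s := s) h).not_gt hs

/-- On every type of cardinality at most `μ`, there are at most `μ` sets of cardinality at most
`lam` that cover all sets of cardinality at most `lam`. -/
def SmallCovering (lam μ : Cardinal.{u}) : Prop :=
  ∀ Z : Type u, #Z ≤ μ → ∃ P : Set (Set Z), #P ≤ μ ∧ (∀ t ∈ P, #t ≤ lam) ∧
    ∀ s : Set Z, #s ≤ lam → ∃ t ∈ P, s ⊆ t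

theorem SmallCovering.self {lam : Cardinal.{u}} (hlam : ℵ₀ ≤ lam) : SmallCovering lam lam := by
  intro Z hZ
  refine ⟨{Set.univ}, ?_, ?_, fun s _ => ⟨Set.univ, rfl, Set.subset_univ s⟩⟩
  · simpa using one_le_aleph0.trans hlam
  · rintro t rfl
    simpa using hZ

theorem SmallCovering.succ {lam μ : Cardinal.{u}} (hlam : ℵ₀ ≤ lam) (hμ : lam ≤ μ)
    (h : SmallCovering lam μ) : SmallCovering lam (Order.succ μ) := by
  intro Z hZ
  obtain ⟨g⟩ : Nonempty (Z ↪ (Order.succ μ).ord.ToType) := by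
    rw [← Cardinal.le_def]
    simpa using hZ
  have hsmall : ∀ a, #{z // g z < a} ≤ μ := fun a => by
    have hle : #{z // g z < a} ≤ #(Set.Iio a) :=
      mk_le_of_injective (f := fun z => ⟨g z.1, z.2⟩) fun x y hxy =>
        Subtype.ext (g.injective (congrArg Subtype.val hxy))
    have hlt : #(Set.Iio a) < Order.succ μ := by simpa using mk_Iio_lt a
    exact hle.trans (Order.lt_succ_iff.1 hlt)
  choose P hP hPle hPcov using fun a => h _ (hsmall a)
  have hinf : ℵ₀ ≤ Order.succ μ := (hlam.trans hμ).trans (Order.le_succ μ)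
  refine ⟨⋃ a, (fun t => Subtype.val '' t) '' P a, ?_, ?_, ?_⟩
  · refine (mk_iUnion_le _).trans ?_
    rw [mk_toType, card_ord]
    refine (mul_le_mul' le_rfl (ciSup_le' fun a => ?_)).trans (mul_eq_self hinf).le
    exact (mk_image_le.trans (hP a)).trans (Order.le_succ μ)
  · intro t ht
    obtain ⟨a, r, hr, rfl⟩ := Set.mem_iUnion.1 ht
    exact mk_image_le.trans (hPle a r hr)
  · intro s hs
    obtain ⟨a, ha⟩ := exists_forall_lt_of_mk_lt_cof (s := g '' s) (by
      rw [cof_toType, (isRegular_succ (hlam.trans hμ)).cof_ord, Order.lt_succ_iff]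
      exact (mk_image_le.trans hs).trans hμ)
    obtain ⟨t, ht, hst⟩ := hPcov a (Subtype.val ⁻¹' s)
      ((mk_preimage_of_injective _ _ Subtype.val_injective).trans hs)
    refine ⟨Subtype.val '' t, Set.mem_iUnion.2 ⟨a, t, ht, rfl⟩, fun z hz => ?_⟩
    exact ⟨⟨z, ha _ ⟨z, hz, rfl⟩⟩, hst hz, rfl⟩

/-- If `Y` has small coverings and `A` has large cofinality, then for unboundedly many `a : A` the
values of `f a` on a small set stay inside one fixed small set. -/
theorem exists_small_set_containing_cofinal_images {lam κ : Cardinal.{u}} {A D Y : Type u}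
    [LinearOrder A] (hA : κ < Order.cof A) (hY : #Y ≤ κ) (hcov : SmallCovering lam κ)
    (f : A → D → Y) {B : Set D} (hB : #B ≤ lam) :
    ∃ M : Set Y, #M ≤ lam ∧ ∀ a, ∃ b, a < b ∧ f b '' B ⊆ M := by
  obtain ⟨P, hP, hPle, hPcov⟩ := hcov Y hY
  by_contra! h
  have : Nonempty A := Order.cof_ne_zero_iff.1 (pos_of_gt hA).ne'
  choose! bd hbd using fun M (hM : M ∈ P) => h M (hPle M hM)
  obtain ⟨a, ha⟩ := exists_forall_lt_of_mk_lt_cof (s := bd '' P)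
    ((mk_image_le.trans hP).trans_lt hA)
  obtain ⟨M, hM, hsub⟩ := hPcov (f a '' B) (mk_image_le.trans hB)
  exact hbd M hM a (ha _ ⟨M, hM, rfl⟩) hsub

/-- In an order of cofinality above `κ`, one can iterate a map `next` along any well-order of
cardinality at most `κ`. -/
theorem exists_chain_above_next {κ : Cardinal.{u}} {A W : Type u} [LinearOrder A]
    [LinearOrder W] [WellFoundedLT W] (hA : κ < Order.cof A) (hW : #W ≤ κ) (next : A → A) :
    ∃ k : W → A, ∀ μ ν, μ < ν → next (k μ) < k ν := by
  have hbound : ∀ (ν : W) (g : Set.Iio ν → A), ∃ a, ∀ μ, next (g μ) < a := fun ν g => by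
    obtain ⟨a, ha⟩ := exists_forall_lt_of_mk_lt_cof (s := Set.range fun μ => next (g μ))
      ((mk_range_le.trans ((mk_set_le _).trans hW)).trans_lt hA)
    exact ⟨a, fun μ => ha _ ⟨μ, rfl⟩⟩
  choose bd hbd using hbound
  let k : W → A := wellFounded_lt.fix fun ν g => bd ν fun μ => g μ.1 μ.2
  refine ⟨k, fun μ ν hμν => ?_⟩
  have hk : k ν = bd ν fun μ => k μ.1 := wellFounded_lt.fix_eq _ ν
  rw [hk]
  exact hbd ν (fun μ => k μ.1) ⟨μ, hμν⟩

/-- A chain of functions into a type of cardinality at most `lam⁺⁺`, on a domain of cardinality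
`lam⁺⁺`, that increases modulo sets of cardinality less than `lam`, cannot be indexed by a linear
order of cofinality above `lam⁺⁺`. -/
theorem no_chain_mod_small_sets_of_lt_cof {lam : Cardinal.{u}} (hlam : ℵ₀ ≤ lam)
    {A D Y : Type u} [LinearOrder A] [Preorder Y]
    (hA : Order.succ (Order.succ lam) < Order.cof A)
    (hD : #D = Order.succ (Order.succ lam)) (hY : #Y ≤ Order.succ (Order.succ lam))
    (f : A → D → Y) (hf : ∀ a b, a < b → #{x | ¬ f a x < f b x} < lam) : False := by
  have hlam₁ : lam ≤ Order.succ lam := Order.le_succ lam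
  have hlam₂ : Order.succ lam ≤ Order.succ (Order.succ lam) := Order.le_succ _
  have hcov : SmallCovering lam (Order.succ (Order.succ lam)) :=
    ((SmallCovering.self hlam).succ hlam le_rfl).succ hlam hlam₁
  -- Split the domain into `lam⁺⁺` blocks of cardinality `lam`.
  obtain ⟨e⟩ : Nonempty (D × lam.out ≃ D) := by
    rw [← Cardinal.eq, mk_prod, Cardinal.lift_id, Cardinal.lift_id, mk_out, hD]
    exact mul_eq_left (hlam.trans (hlam₁.trans hlam₂)) (hlam₁.trans hlam₂)
      (aleph0_pos.trans_le hlam).ne'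
  let B : D → Set D := fun i => Set.range fun l => e (i, l)
  have hB : ∀ i, #(B i) = lam := fun i => by
    rw [mk_range_eq _ fun l l' h => (Prod.ext_iff.1 (e.injective h)).2, mk_out]
  choose M hM hcof using fun i =>
    exists_small_set_containing_cofinal_images hA hY hcov f (hB i).le
  choose wit hwit hwitM using hcof
  have hnext : ∀ a, ∃ b, ∀ i, wit i a < b := fun a => by
    obtain ⟨b, hb⟩ := exists_forall_lt_of_mk_lt_cof (s := Set.range fun i => wit i a)
      ((mk_range_le.trans hD.le).trans_lt hA)
    exact ⟨b, fun i => hb _ ⟨i, rfl⟩⟩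
  choose next hnext using hnext
  obtain ⟨k, hk⟩ := exists_chain_above_next (W := (Order.succ lam).ord.ToType) hA
    (by simpa using hlam₂) next
  -- Some block avoids all exceptional sets of the chain.
  let U : Set D := ⋃ p : {p : (Order.succ lam).ord.ToType × (Order.succ lam).ord.ToType //
    p.1 < p.2}, {x | ¬ f (next (k p.1.1)) x < f (k p.1.2) x}
  have hU : #U ≤ Order.succ lam := by
    refine (mk_iUnion_le _).trans ?_
    have hinf : ℵ₀ ≤ Order.succ lam := hlam.trans hlam₁
    refine (mul_le_mul' ?_ (ciSup_le' fun p => ?_)).trans (mul_eq_self hinf).le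
    · refine (mk_subtype_le _).trans ?_
      simpa using (mul_eq_self hinf).le
    · exact (hf _ _ (hk _ _ p.2)).le.trans hlam₁
  obtain ⟨i, hi⟩ : ∃ i, i ∉ (fun x => (e.symm x).1) '' U := by
    by_contra! h
    have hle : #D ≤ Order.succ lam := by
      rw [← mk_univ, ← Set.eq_univ_of_forall h]
      exact mk_image_le.trans hU
    rw [hD] at hle
    exact (Order.lt_succ (Order.succ lam)).not_ge hle
  have hpt : ∀ ν, ∃ x ∈ B i, f (k ν) x < f (wit i (k ν)) x ∧
      f (wit i (k ν)) x < f (next (k ν)) x := fun ν => by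
    by_contra! h
    have hsub : B i ⊆ {x | ¬ f (k ν) x < f (wit i (k ν)) x} ∪
        {x | ¬ f (wit i (k ν)) x < f (next (k ν)) x} := fun x hx => by
      by_cases hx' : f (k ν) x < f (wit i (k ν)) x
      · exact Or.inr (h x hx hx')
      · exact Or.inl hx'
    have hlt := ((mk_le_mk_of_subset hsub).trans (mk_union_le _ _)).trans_lt
      (add_lt_of_lt hlam (hf _ _ (hwit i (k ν))) (hf _ _ (hnext (k ν) i)))
    exact hlt.ne (hB i)
  choose x hxB hx₁ hx₂ using hpt
  have hclash : ∀ μ ν, μ < ν → x μ = x ν → f (wit i (k μ)) (x μ) ≠ f (wit i (k ν)) (x ν) := by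
    intro μ ν hμν hxx heq
    have hmid : f (next (k μ)) (x ν) < f (k ν) (x ν) := by
      by_contra hcon
      obtain ⟨l, hl⟩ := hxB ν
      refine hi ⟨x ν, Set.mem_iUnion.2 ⟨⟨(μ, ν), hμν⟩, hcon⟩, ?_⟩
      simp [← hl]
    have h₂ := hx₂ μ
    rw [heq, hxx] at h₂
    exact lt_irrefl _ ((h₂.trans hmid).trans (hx₁ ν))
  have hinj : Function.Injective fun ν => ((⟨x ν, hxB ν⟩,
      ⟨f (wit i (k ν)) (x ν), hwitM i (k ν) ⟨x ν, hxB ν, rfl⟩⟩) : B i × M i) := by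
    intro μ ν h
    simp only [Prod.mk.injEq, Subtype.mk.injEq] at h
    rcases lt_trichotomy μ ν with hlt | heq | hgt
    · exact (hclash μ ν hlt h.1 h.2).elim
    · exact heq
    · exact (hclash ν μ hgt h.1.symm h.2.symm).elim
  have hle := mk_le_of_injective hinj
  rw [mk_toType, card_ord, mk_prod, Cardinal.lift_id, Cardinal.lift_id, hB i] at hle
  exact (Order.lt_succ lam).not_ge
    (hle.trans ((mul_le_mul' le_rfl (hM i)).trans (mul_eq_self hlam).le))

/-- For every infinite cardinal `λ`, there is no sequence `⟨f_α : α < λ⁺⁺⁺⟩` of functions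
from `λ⁺⁺` to `λ⁺⁺` increasing modulo the ideal `[λ⁺⁺]^{<λ}`: i.e. no such sequence with
`|{ξ < λ⁺⁺ : f_α(ξ) ≥ f_β(ξ)}| < λ` for all `α < β < λ⁺⁺⁺`. -/
theorem no_chain_of_functions_increasing_mod_small_sets
    (lam : Cardinal.{0}) (hlam : Cardinal.aleph0 ≤ lam) :
    ¬ ∃ f : Ordinal →
        ({ξ : Ordinal.{0} // ξ < (Order.succ (Order.succ lam)).ord} →
          {ξ : Ordinal.{0} // ξ < (Order.succ (Order.succ lam)).ord}),
        ∀ α β : Ordinal, α < β → β < (Order.succ (Order.succ (Order.succ lam))).ord →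
          Cardinal.mk ↥{ξ : {ξ : Ordinal.{0} // ξ < (Order.succ (Order.succ lam)).ord} |
            f β ξ ≤ f α ξ} < Cardinal.lift.{1} lam := by
  rintro ⟨f, hf⟩
  have hinf : ℵ₀ ≤ Order.succ (Order.succ lam) :=
    hlam.trans ((Order.le_succ _).trans (Order.le_succ _))
  have hD : #{ξ : Ordinal.{0} // ξ < (Order.succ (Order.succ lam)).ord} =
      Order.succ (Order.succ (lift.{1} lam)) := by
    rw [← Cardinal.lift_succ, ← Cardinal.lift_succ]
    exact (Cardinal.mk_Iio_ordinal _).trans (by rw [card_ord])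
  refine no_chain_mod_small_sets_of_lt_cof (lam := lift.{1} lam) (by simpa using hlam)
    (A := Set.Iio (Order.succ (Order.succ (Order.succ lam))).ord) ?_ hD hD.le
    (fun a => f a.1) fun a b hab => ?_
  · rw [cof_Iio, ← lift_cof, (isRegular_succ hinf).cof_ord, ← Cardinal.lift_succ,
      ← Cardinal.lift_succ, Cardinal.lift_lt]
    exact Order.lt_succ _
  · simpa only [not_lt] using hf a.1 b.1 hab b.2
end
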